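/- Let μ, κ, γ, M₀, T₀ > 0, let (P,γ) be an admissible pair with pressure potential W, and let (ρ,u,c) be a smooth periodic solution of the non-local Navier–Stokes–Korteweg system on [0,T₀) with initial data (ρ₀,u₀) satisfying M₀⁻¹ ≤ ρ₀(x) ≤ M₀ for all x. Then there exists a constant C(T₀) > 0, depending only on ‖ρ₀‖_{H¹(𝕋)}, ‖u₀‖_{H¹(𝕋)}, M₀, μ, κ, γ, W and T₀, such that sup_{t∈[0,T₀)} ‖ρ(t,·)‖_{H¹(𝕋)} ≤ C(T₀). -/

import Mathlib

open MeasureTheory Filter Set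

/-- The `L²` norm of a `1`-periodic function, computed over one period. -/
noncomputable def L2norm (f : ℝ → ℝ) : ℝ := Real.sqrt (∫ x in (0:ℝ)..1, f x ^ 2)

/-- The `H¹` norm of a `1`-periodic function, computed over one period. -/
noncomputable def H1norm (f : ℝ → ℝ) : ℝ :=
  Real.sqrt (∫ x in (0:ℝ)..1, f x ^ 2 + deriv f x ^ 2)

/-- The `H²` norm of a `1`-periodic function, computed over one period. -/
noncomputable def H2norm (f : ℝ → ℝ) : ℝ :=
  Real.sqrt (∫ x in (0:ℝ)..1, f x ^ 2 + deriv f x ^ 2 + deriv (deriv f) x ^ 2)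

/-- The sup-norm of a `1`-periodic function, computed over one period. -/
noncomputable def LinfNorm (f : ℝ → ℝ) : ℝ := sSup ((fun x => |f x|) '' Set.Icc (0:ℝ) 1)

/-- The `W^{1,∞}` norm of a `1`-periodic function. -/
noncomputable def W1infNorm (f : ℝ → ℝ) : ℝ := LinfNorm f + LinfNorm (deriv f)

/-- The artificial pressure `P_γ(r) = P(r) + (γ/2) r²`. -/
noncomputable def artificialPressure (P : ℝ → ℝ) (γ : ℝ) (r : ℝ) : ℝ := P r + γ / 2 * r ^ 2

/-- A pair `(P, γ)` is admissible (with exponent `β` and limit `a`). -/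
structure IsAdmissiblePair (P : ℝ → ℝ) (γ β a : ℝ) : Prop where
  gamma_pos : 0 < γ
  beta_ge : 2 ≤ β
  a_pos : 0 < a
  nonneg : ∀ r, 0 ≤ r → 0 ≤ P r
  smooth : ContDiffOn ℝ 1 P (Set.Ici 0)
  zero : P 0 = 0
  lim : Filter.Tendsto (fun r => deriv P r / r ^ (β - 1)) Filter.atTop (nhds a)
  mono : MonotoneOn (artificialPressure P γ) (Set.Ici 0)

/-- `W` is a pressure potential for `P`: `W : [0,∞) → [0,∞)`, twice continuously
differentiable on `(0,∞)`, with `W''(r)·r = P'(r)` for `r > 0`. -/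
structure IsPressurePotential (P W : ℝ → ℝ) : Prop where
  nonneg : ∀ r, 0 ≤ r → 0 ≤ W r
  smooth : ContDiffOn ℝ 2 W (Set.Ioi 0)
  relation : ∀ r : ℝ, 0 < r → deriv (deriv W) r * r = deriv P r

/-- A smooth `1`-periodic-in-space solution of the non-local Navier–Stokes–Korteweg
system on the time set `S`, with initial data `(ρ₀, u₀)`. -/
structure IsNSKSolution (μ κ γ : ℝ) (P : ℝ → ℝ) (S : Set ℝ)
    (ρ u c : ℝ → ℝ → ℝ) (ρ₀ u₀ : ℝ → ℝ) : Prop where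
  smooth_rho : ContDiffOn ℝ (⊤ : ℕ∞) (fun p : ℝ × ℝ => ρ p.1 p.2) (S ×ˢ (Set.univ : Set ℝ))
  smooth_u : ContDiffOn ℝ (⊤ : ℕ∞) (fun p : ℝ × ℝ => u p.1 p.2) (S ×ˢ (Set.univ : Set ℝ))
  smooth_c : ContDiffOn ℝ (⊤ : ℕ∞) (fun p : ℝ × ℝ => c p.1 p.2) (S ×ˢ (Set.univ : Set ℝ))
  periodic_rho : ∀ t x, ρ t (x + 1) = ρ t x
  periodic_u : ∀ t x, u t (x + 1) = u t x
  periodic_c : ∀ t x, c t (x + 1) = c t x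
  rho_pos : ∀ t x, 0 < ρ t x
  mass : ∀ t ∈ S, ∀ x : ℝ,
    deriv (fun s => ρ s x) t + deriv (fun y => ρ t y * u t y) x = 0
  momentum : ∀ t ∈ S, ∀ x : ℝ,
    deriv (fun s => ρ s x * u s x) t
      + deriv (fun y => ρ t y * u t y ^ 2) x
      + deriv (fun y => P (ρ t y)) x
      - μ * deriv (deriv (u t)) x
      - γ * ρ t x * deriv (fun y => c t y - ρ t y) x = 0
  elliptic : ∀ t ∈ S, ∀ x : ℝ,
    -κ * deriv (deriv (c t)) x + γ * (c t x - ρ t x) = 0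
  init_rho : ∀ x, ρ 0 x = ρ₀ x
  init_u : ∀ x, u 0 x = u₀ x


open scoped ContDiff Topology Interval

/-- The space derivative along a slice is the Fréchet derivative in the direction `(0, 1)`. -/
lemma hasDerivAt_slice_right {S : Set ℝ} {f : ℝ → ℝ → ℝ} {n : ℕ∞ω} (hn : n ≠ 0)
    (hf : ContDiffOn ℝ n (fun p : ℝ × ℝ => f p.1 p.2) (S ×ˢ univ)) {t : ℝ} (ht : t ∈ S) (x : ℝ) :
    HasDerivAt (f t)
      (fderivWithin ℝ (fun p : ℝ × ℝ => f p.1 p.2) (S ×ˢ univ) (t, x) (0, 1)) x := by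
  have h1 := ((hf.differentiableOn hn) (t, x) ⟨ht, mem_univ x⟩).hasFDerivWithinAt
  have h2 : HasDerivWithinAt (fun y : ℝ => (t, y)) ((0 : ℝ), (1 : ℝ)) univ x :=
    ((hasDerivAt_const x t).prodMk (hasDerivAt_id x)).hasDerivWithinAt
  have h3 := h1.comp_hasDerivWithinAt x h2 (fun y _ => ⟨ht, mem_univ y⟩)
  exact h3.hasDerivAt univ_mem

lemma contDiffOn_deriv_right {S : Set ℝ} (hS : UniqueDiffOn ℝ S) {f : ℝ → ℝ → ℝ} {m n : ℕ∞ω}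
    (hmn : m + 1 ≤ n)
    (hf : ContDiffOn ℝ n (fun p : ℝ × ℝ => f p.1 p.2) (S ×ˢ univ)) :
    ContDiffOn ℝ m (fun p : ℝ × ℝ => deriv (f p.1) p.2) (S ×ˢ univ) := by
  have hn : n ≠ 0 := by
    rintro rfl
    simp at hmn
  have h := (hf.fderivWithin (hS.prod uniqueDiffOn_univ) hmn).clm_apply
    (contDiffOn_const (c := ((0 : ℝ), (1 : ℝ))))
  refine h.congr fun p hp => ?_
  exact (hasDerivAt_slice_right hn hf hp.1 p.2).deriv

lemma differentiable_slice_right {S : Set ℝ} {f : ℝ → ℝ → ℝ} {n : ℕ∞ω} (hn : n ≠ 0)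
    (hf : ContDiffOn ℝ n (fun p : ℝ × ℝ => f p.1 p.2) (S ×ˢ univ)) {t : ℝ} (ht : t ∈ S) :
    Differentiable ℝ (f t) :=
  fun x => (hasDerivAt_slice_right hn hf ht x).differentiableAt

lemma continuous_slice_right {S : Set ℝ} {f : ℝ → ℝ → ℝ}
    (hf : ContinuousOn (fun p : ℝ × ℝ => f p.1 p.2) (S ×ˢ univ)) {t : ℝ} (ht : t ∈ S) :
    Continuous (f t) :=
  hf.comp_continuous (f := fun y : ℝ => (t, y)) (by fun_prop) fun y => ⟨ht, mem_univ y⟩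

/-- The time derivative along a slice is the Fréchet derivative in the direction `(1, 0)`. -/
lemma hasDerivAt_slice_left {S : Set ℝ} (hS : IsOpen S) {f : ℝ → ℝ → ℝ} {n : ℕ∞ω} (hn : n ≠ 0)
    (hf : ContDiffOn ℝ n (fun p : ℝ × ℝ => f p.1 p.2) (S ×ˢ univ)) {t : ℝ} (ht : t ∈ S) (x : ℝ) :
    HasDerivAt (fun s => f s x) (fderiv ℝ (fun p : ℝ × ℝ => f p.1 p.2) (t, x) (1, 0)) t := by
  have hmem : S ×ˢ (univ : Set ℝ) ∈ 𝓝 (t, x) :=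
    (hS.prod isOpen_univ).mem_nhds ⟨ht, mem_univ x⟩
  have h1 := ((hf.differentiableOn hn).differentiableAt hmem).hasFDerivAt
  exact h1.comp_hasDerivAt (f := fun s : ℝ => (s, x)) t
    ((hasDerivAt_id t).prodMk (hasDerivAt_const t x))

lemma contDiffOn_deriv_left {S : Set ℝ} (hS : IsOpen S) {f : ℝ → ℝ → ℝ} {m n : ℕ∞ω}
    (hmn : m + 1 ≤ n)
    (hf : ContDiffOn ℝ n (fun p : ℝ × ℝ => f p.1 p.2) (S ×ˢ univ)) :
    ContDiffOn ℝ m (fun p : ℝ × ℝ => deriv (fun s => f s p.2) p.1) (S ×ˢ univ) := by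
  have hn : n ≠ 0 := by
    rintro rfl
    simp at hmn
  have h := (hf.fderiv_of_isOpen (hS.prod isOpen_univ) hmn).clm_apply
    (contDiffOn_const (c := ((1 : ℝ), (0 : ℝ))))
  refine h.congr fun p hp => ?_
  exact (hasDerivAt_slice_left hS hn hf hp.1 p.2).deriv

/-- Time and space derivatives commute. -/
lemma deriv_deriv_comm {S : Set ℝ} (hS : IsOpen S) {f : ℝ → ℝ → ℝ}
    (hf : ContDiffOn ℝ 2 (fun p : ℝ × ℝ => f p.1 p.2) (S ×ˢ univ)) {t : ℝ} (ht : t ∈ S) (x : ℝ) :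
    deriv (fun s => deriv (f s) x) t = deriv (fun y => deriv (fun s => f s y) t) x := by
  set F : ℝ × ℝ → ℝ := fun p => f p.1 p.2 with hF
  have hmem : S ×ˢ (univ : Set ℝ) ∈ 𝓝 (t, x) :=
    (hS.prod isOpen_univ).mem_nhds ⟨ht, mem_univ x⟩
  have hsymm : IsSymmSndFDerivAt ℝ F (t, x) :=
    (hf.contDiffAt hmem).isSymmSndFDerivAt (by simp)
  have hD : HasFDerivAt (fderiv ℝ F) (fderiv ℝ (fderiv ℝ F) (t, x)) (t, x) :=
    (((hf.fderiv_of_isOpen (m := 1) (hS.prod isOpen_univ) (by norm_num)).differentiableOn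
      one_ne_zero).differentiableAt hmem).hasFDerivAt
  have hL : HasDerivAt (fun s => fderiv ℝ F (s, x) (0, 1))
      (fderiv ℝ (fderiv ℝ F) (t, x) (1, 0) (0, 1)) t := by
    have := hD.comp_hasDerivAt (f := fun s : ℝ => (s, x)) t
      ((hasDerivAt_id t).prodMk (hasDerivAt_const t x))
    simpa using this.clm_apply (hasDerivAt_const t ((0 : ℝ), (1 : ℝ)))
  have hR : HasDerivAt (fun y => fderiv ℝ F (t, y) (1, 0))
      (fderiv ℝ (fderiv ℝ F) (t, x) (0, 1) (1, 0)) x := by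
    have := hD.comp_hasDerivAt (f := fun y : ℝ => (t, y)) x
      ((hasDerivAt_const x t).prodMk (hasDerivAt_id x))
    simpa using this.clm_apply (hasDerivAt_const x ((1 : ℝ), (0 : ℝ)))
  have e1 : (fun s => deriv (f s) x) =ᶠ[𝓝 t] fun s => fderiv ℝ F (s, x) (0, 1) := by
    filter_upwards [hS.mem_nhds ht] with s hs
    rw [(hasDerivAt_slice_right two_ne_zero hf hs x).deriv,
      fderivWithin_of_isOpen (hS.prod isOpen_univ) ⟨hs, mem_univ x⟩]
  have e2 : (fun y => deriv (fun s => f s y) t) = fun y => fderiv ℝ F (t, y) (1, 0) :=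
    funext fun y => (hasDerivAt_slice_left hS two_ne_zero hf ht y).deriv
  rw [e1.deriv_eq, e2, hL.deriv, hR.deriv]
  exact hsymm _ _

lemma continuousOn_integral_slice {S : Set ℝ} {g : ℝ → ℝ → ℝ}
    (hg : ContinuousOn (fun p : ℝ × ℝ => g p.1 p.2) (S ×ˢ univ)) :
    ContinuousOn (fun t => ∫ x in (0 : ℝ)..1, g t x) S := by
  rw [continuousOn_iff_continuous_domRestrict]
  refine intervalIntegral.continuous_parametric_intervalIntegral_of_continuous'
    (f := fun (t : S) x => g t x) ?_ 0 1
  exact hg.comp_continuous (f := fun p : S × ℝ => ((p.1 : ℝ), p.2)) (by fun_prop)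
    fun p => ⟨p.1.2, mem_univ _⟩

lemma hasDerivAt_integral_slice {S : Set ℝ} (hS : IsOpen S) {g : ℝ → ℝ → ℝ}
    (hg : ContDiffOn ℝ 1 (fun p : ℝ × ℝ => g p.1 p.2) (S ×ˢ univ)) {t : ℝ} (ht : t ∈ S) :
    HasDerivAt (fun s => ∫ x in (0 : ℝ)..1, g s x)
      (∫ x in (0 : ℝ)..1, deriv (fun s => g s x) t) t := by
  have hg' : ContinuousOn (fun p : ℝ × ℝ => deriv (fun s => g s p.2) p.1) (S ×ˢ univ) :=
    (contDiffOn_deriv_left (m := 0) hS (by norm_num) hg).continuousOn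
  obtain ⟨ε, hε, hball⟩ := Metric.nhds_basis_closedBall.mem_iff.1 (hS.mem_nhds ht)
  obtain ⟨M, hM⟩ := ((isCompact_closedBall t ε).prod (isCompact_Icc (a := (0 : ℝ)) (b := 1))
    ).exists_bound_of_continuousOn (hg'.mono (prod_mono hball (subset_univ _)))
  have hI : Ι (0 : ℝ) 1 ⊆ Icc 0 1 := by
    rw [uIoc_of_le zero_le_one]
    exact Ioc_subset_Icc_self
  refine (intervalIntegral.hasDerivAt_integral_of_dominated_loc_of_deriv_le
    (F' := fun s x => deriv (fun r => g r x) s) (bound := fun _ => M)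
    (Metric.closedBall_mem_nhds t hε) ?_ ?_ ?_ ?_ ?_ ?_).2
  · filter_upwards [hS.mem_nhds ht] with s hs
    exact (continuous_slice_right hg.continuousOn hs).aestronglyMeasurable
  · exact (continuous_slice_right hg.continuousOn ht).intervalIntegrable _ _
  · exact (continuous_slice_right (f := fun s x => deriv (fun r => g r x) s) hg' ht
      ).aestronglyMeasurable
  · exact ae_of_all _ fun x hx s hs => hM (s, x) ⟨hs, hI hx⟩
  · exact intervalIntegrable_const
  · exact ae_of_all _ fun x _ s hs =>
      (hasDerivAt_slice_left hS one_ne_zero hg (hball hs) x).differentiableAt.hasDerivAt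

lemma integral_deriv_eq_zero_of_periodic {h : ℝ → ℝ} (hd : Differentiable ℝ h)
    (hc : Continuous (deriv h)) (hp : ∀ x, h (x + 1) = h x) :
    ∫ x in (0 : ℝ)..1, deriv h x = 0 := by
  rw [intervalIntegral.integral_deriv_eq_sub (fun x _ => hd x) (hc.intervalIntegrable _ _)]
  have := hp 0
  simp only [zero_add] at this
  rw [this, sub_self]

/-- Integrated balance law for a density `g` and a spatially periodic flux `h`. -/
lemma hasDerivAt_integral_balance {S : Set ℝ} (hS : IsOpen S) {g h : ℝ → ℝ → ℝ}
    (hg : ContDiffOn ℝ 1 (fun p : ℝ × ℝ => g p.1 p.2) (S ×ˢ univ))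
    (hh : ContDiffOn ℝ 1 (fun p : ℝ × ℝ => h p.1 p.2) (S ×ˢ univ))
    (hp : ∀ t x, h t (x + 1) = h t x) {t : ℝ} (ht : t ∈ S) :
    Continuous (fun x => deriv (fun s => g s x) t + deriv (h t) x) ∧
    HasDerivAt (fun s => ∫ x in (0 : ℝ)..1, g s x)
      (∫ x in (0 : ℝ)..1, (deriv (fun s => g s x) t + deriv (h t) x)) t := by
  have c1 : Continuous fun x => deriv (fun s => g s x) t :=
    continuous_slice_right (f := fun s x => deriv (fun r => g r x) s)
      (contDiffOn_deriv_left (m := 0) hS (by norm_num) hg).continuousOn ht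
  have c2 : Continuous (deriv (h t)) :=
    continuous_slice_right (f := fun s x => deriv (h s) x)
      (contDiffOn_deriv_right (m := 0) hS.uniqueDiffOn (by norm_num) hh).continuousOn ht
  refine ⟨c1.add c2, ?_⟩
  rw [intervalIntegral.integral_add (c1.intervalIntegrable _ _) (c2.intervalIntegrable _ _),
    integral_deriv_eq_zero_of_periodic (differentiable_slice_right one_ne_zero hh ht) c2 (hp t),
    add_zero]
  exact hasDerivAt_integral_slice hS hg ht

lemma deriv_periodic {f : ℝ → ℝ} (hp : ∀ x, f (x + 1) = f x) (x : ℝ) :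
    deriv f (x + 1) = deriv f x := by
  rw [← deriv_comp_add_const]
  exact congrArg (fun f => deriv f x) (funext hp)

lemma abs_integral_le_abs_integral_abs (f : ℝ → ℝ) (a b : ℝ) :
    |∫ x in a..b, f x| ≤ |∫ x in a..b, (|f x|)| := by
  simpa only [Real.norm_eq_abs] using
    intervalIntegral.norm_integral_le_abs_integral_norm (f := f) (a := a) (b := b) (μ := volume)

/-- Maximum principle for the screened Poisson equation with positive source. -/
lemma nonneg_of_elliptic {κ γ : ℝ} {c r : ℝ → ℝ} (hκ : 0 < κ) (hγ : 0 < γ)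
    (hc : Continuous c) (hp : ∀ x, c (x + 1) = c x) (hr : ∀ x, 0 < r x)
    (he : ∀ x, -κ * deriv (deriv c) x + γ * (c x - r x) = 0) :
    (∀ x, 0 ≤ c x) ∧ ∃ x₀ ∈ Icc (0 : ℝ) 1, deriv c x₀ = 0 := by
  obtain ⟨x₀, hx₀, hmin⟩ := isCompact_Icc.exists_isMinOn
    (nonempty_Icc.2 (zero_le_one (α := ℝ))) hc.continuousOn
  have hper : Function.Periodic c 1 := hp
  have hglob : ∀ x, c x₀ ≤ c x := by
    intro x
    obtain ⟨y, hy, hxy⟩ := hper.exists_mem_Ico₀ zero_lt_one x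
    rw [hxy]
    exact hmin (Ico_subset_Icc_self hy)
  have hloc : IsLocalMin c x₀ := Eventually.of_forall hglob
  refine ⟨fun x => ?_, x₀, hx₀, hloc.deriv_eq_zero⟩
  by_contra! hneg
  have hlt : c x₀ < 0 := (hglob x).trans_lt hneg
  have hdd : deriv (deriv c) x₀ < 0 := by
    have h1 := he x₀
    have h2 : γ * (c x₀ - r x₀) < 0 := mul_neg_of_pos_of_neg hγ (by linarith [hr x₀])
    by_contra! h3
    nlinarith [mul_nonneg hκ.le h3]
  have hmax := isLocalMax_of_deriv_deriv_neg hdd hloc.deriv_eq_zero hc.continuousAt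
  have hconst : c =ᶠ[𝓝 x₀] fun _ => c x₀ := by
    filter_upwards [hmax] with y hy
    exact le_antisymm hy (hglob y)
  have : deriv (deriv c) x₀ = 0 := by
    rw [hconst.deriv.deriv_eq]
    simp
  linarith

/-- Gradient bound for the screened Poisson equation in terms of the mass of the source. -/
lemma abs_deriv_le_of_elliptic {κ γ : ℝ} {c r : ℝ → ℝ} (hκ : 0 < κ) (hγ : 0 < γ)
    (hc : Differentiable ℝ c) (hc' : Differentiable ℝ (deriv c))
    (hc'' : Continuous (deriv (deriv c))) (hp : ∀ x, c (x + 1) = c x)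
    (hrc : Continuous r) (hr : ∀ x, 0 < r x)
    (he : ∀ x, -κ * deriv (deriv c) x + γ * (c x - r x) = 0) {x : ℝ} (hx : x ∈ Icc (0 : ℝ) 1) :
    |deriv c x| ≤ 2 * γ / κ * ∫ y in (0 : ℝ)..1, r y := by
  obtain ⟨hc0, x₀, hx₀, hd⟩ := nonneg_of_elliptic hκ hγ hc.continuous hp hr he
  have hdd : ∀ y, deriv (deriv c) y = γ / κ * (c y - r y) := by
    intro y
    have := he y
    field_simp
    linarith
  have hp' := deriv_periodic hp
  have hmass : ∫ y in (0 : ℝ)..1, c y = ∫ y in (0 : ℝ)..1, r y := by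
    have h0 := integral_deriv_eq_zero_of_periodic hc' hc'' hp'
    simp only [hdd] at h0
    rw [intervalIntegral.integral_const_mul, intervalIntegral.integral_sub
      (hc.continuous.intervalIntegrable _ _) (hrc.intervalIntegrable _ _)] at h0
    have : γ / κ ≠ 0 := by positivity
    have := (mul_eq_zero.1 h0).resolve_left this
    linarith
  have hftc : deriv c x = ∫ y in x₀..x, deriv (deriv c) y := by
    rw [intervalIntegral.integral_deriv_eq_sub (fun y _ => hc' y)
      (hc''.intervalIntegrable _ _), hd, sub_zero]
  have hsub : Ι x₀ x ⊆ Ι (0 : ℝ) 1 := by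
    rw [uIoc_of_le zero_le_one]
    exact Ioc_subset_Ioc (le_min hx₀.1 hx.1) (max_le hx₀.2 hx.2)
  calc |deriv c x| = |∫ y in x₀..x, deriv (deriv c) y| := by rw [← hftc]
    _ ≤ |∫ y in x₀..x, (|deriv (deriv c) y|)| := abs_integral_le_abs_integral_abs _ _ _
    _ ≤ |∫ y in (0 : ℝ)..1, (|deriv (deriv c) y|)| :=
        intervalIntegral.abs_integral_mono_interval hsub
          (ae_of_all _ fun y => abs_nonneg _) (hc''.abs.intervalIntegrable _ _)
    _ = ∫ y in (0 : ℝ)..1, (|deriv (deriv c) y|) :=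
        abs_of_nonneg (intervalIntegral.integral_nonneg zero_le_one fun y _ => abs_nonneg _)
    _ ≤ ∫ y in (0 : ℝ)..1, γ / κ * (c y + r y) := by
        refine intervalIntegral.integral_mono_on zero_le_one (hc''.abs.intervalIntegrable _ _)
          ((continuous_const.mul (hc.continuous.add hrc)).intervalIntegrable _ _) fun y _ => ?_
        rw [hdd, abs_mul, abs_of_pos (div_pos hγ hκ)]
        refine mul_le_mul_of_nonneg_left ?_ (div_pos hγ hκ).le
        rw [abs_le]
        constructor <;> linarith [hc0 y, hr y]
    _ = 2 * γ / κ * ∫ y in (0 : ℝ)..1, r y := by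
        rw [intervalIntegral.integral_const_mul, intervalIntegral.integral_add
          (hc.continuous.intervalIntegrable _ _) (hrc.intervalIntegrable _ _), hmass]
        ring

/-- A positive function of bounded mass with finite Fisher-type information
`∫ (r')² / r³` is bounded above. -/
lemma le_exp_of_integral_le {r : ℝ → ℝ} {M L : ℝ} (hM : 0 < M) (hr : ∀ x, 0 < r x)
    (hd : Differentiable ℝ r) (hd' : Continuous (deriv r))
    (hmass : ∫ x in (0 : ℝ)..1, r x ≤ M)
    (hL : ∫ x in (0 : ℝ)..1, deriv r x ^ 2 / r x ^ 3 ≤ L) {x : ℝ} (hx : x ∈ Icc (0 : ℝ) 1) :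
    r x ≤ M * Real.exp ((M + L) / 2) := by
  have hc := hd.continuous
  have hne : ∀ y, r y ≠ 0 := fun y => (hr y).ne'
  obtain ⟨y, hy, hyM⟩ : ∃ y ∈ Icc (0 : ℝ) 1, r y ≤ M := by
    by_contra! hcon
    have : ∫ _ in (0 : ℝ)..1, M < ∫ x in (0 : ℝ)..1, r x :=
      intervalIntegral.integral_lt_integral_of_continuousOn_of_le_of_exists_lt zero_lt_one
        continuousOn_const hc.continuousOn (fun z hz => (hcon z (Ioc_subset_Icc_self hz)).le)
        ⟨0, by simp, hcon 0 (by simp)⟩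
    simp at this
    linarith
  have hq : Continuous fun z => deriv r z / r z := hd'.div hc hne
  have hq3 : Continuous fun z => deriv r z ^ 2 / r z ^ 3 :=
    (hd'.pow 2).div (hc.pow 3) fun z => pow_ne_zero _ (hne z)
  have hftc : ∫ z in y..x, deriv r z / r z = Real.log (r x) - Real.log (r y) :=
    intervalIntegral.integral_eq_sub_of_hasDerivAt
      (fun z _ => (hd z).hasDerivAt.log (hne z)) (hq.intervalIntegrable _ _)
  have hsub : Ι y x ⊆ Ι (0 : ℝ) 1 := by
    rw [uIoc_of_le zero_le_one]
    exact Ioc_subset_Ioc (le_min hy.1 hx.1) (max_le hy.2 hx.2)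
  have hbound : Real.log (r x) - Real.log (r y) ≤ (M + L) / 2 := by
    calc Real.log (r x) - Real.log (r y) ≤ |∫ z in y..x, deriv r z / r z| := by
          rw [hftc]
          exact le_abs_self _
      _ ≤ |∫ z in y..x, (|deriv r z / r z|)| :=
          abs_integral_le_abs_integral_abs _ _ _
      _ ≤ |∫ z in (0 : ℝ)..1, (|deriv r z / r z|)| :=
          intervalIntegral.abs_integral_mono_interval hsub
            (ae_of_all _ fun y => abs_nonneg _) (hq.abs.intervalIntegrable _ _)
      _ = ∫ z in (0 : ℝ)..1, (|deriv r z / r z|) :=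
          abs_of_nonneg (intervalIntegral.integral_nonneg zero_le_one fun y _ => abs_nonneg _)
      _ ≤ ∫ z in (0 : ℝ)..1, (r z + deriv r z ^ 2 / r z ^ 3) / 2 := by
          refine intervalIntegral.integral_mono_on zero_le_one (hq.abs.intervalIntegrable _ _)
            (((hc.add hq3).div_const 2).intervalIntegrable _ _) fun z _ => ?_
          have h := hr z
          rw [abs_div, abs_of_pos h, ← sq_abs (deriv r z)]
          have : (r z + |deriv r z| ^ 2 / r z ^ 3) / 2 - |deriv r z| / r z
              = (r z ^ 2 - |deriv r z|) ^ 2 / (2 * r z ^ 3) := by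
            field_simp
            ring
          have : 0 ≤ (r z ^ 2 - |deriv r z|) ^ 2 / (2 * r z ^ 3) := by positivity
          linarith
      _ = ((∫ z in (0 : ℝ)..1, r z) + ∫ z in (0 : ℝ)..1, deriv r z ^ 2 / r z ^ 3) / 2 := by
          rw [intervalIntegral.integral_div, intervalIntegral.integral_add
            (hc.intervalIntegrable _ _) (hq3.intervalIntegrable _ _)]
      _ ≤ (M + L) / 2 := by linarith
  calc r x = Real.exp (Real.log (r x)) := (Real.exp_log (hr x)).symm
    _ ≤ Real.exp (Real.log M + (M + L) / 2) := by
        refine Real.exp_le_exp.2 ?_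
        linarith [Real.log_le_log (hr y) hyM]
    _ = M * Real.exp ((M + L) / 2) := by rw [Real.exp_add, Real.exp_log hM]

/-- Gronwall's inequality on a half-open interval. -/
lemma le_mul_exp_of_deriv_le {T k : ℝ} {G G' : ℝ → ℝ} (hk : 0 ≤ k)
    (hc : ContinuousOn G (Ico 0 T)) (hd : ∀ t ∈ Ioo 0 T, HasDerivAt G (G' t) t)
    (hle : ∀ t ∈ Ioo 0 T, G' t ≤ k * G t) {t : ℝ} (ht : t ∈ Ico 0 T) (h0 : 0 ≤ G 0) :
    G t ≤ G 0 * Real.exp (k * T) := by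
  have hanti : AntitoneOn (fun s => G s * Real.exp (-(k * s))) (Ico 0 T) := by
    have hder : ∀ s ∈ Ioo 0 T, HasDerivAt (fun s => G s * Real.exp (-(k * s)))
        (G' s * Real.exp (-(k * s)) + G s * (Real.exp (-(k * s)) * -(k * 1))) s := fun s hs =>
      (hd s hs).mul (((hasDerivAt_id s).const_mul k).neg.exp)
    refine antitoneOn_of_deriv_nonpos (convex_Ico 0 T) (hc.mul (by fun_prop)) ?_ ?_
    · rw [interior_Ico]
      exact fun s hs => (hder s hs).differentiableAt.differentiableWithinAt
    · rw [interior_Ico]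
      intro s hs
      rw [(hder s hs).deriv]
      nlinarith [hle s hs, Real.exp_pos (-(k * s))]
  have h := hanti ⟨le_rfl, ht.1.trans_lt ht.2⟩ ht ht.1
  simp only [mul_zero, neg_zero, Real.exp_zero, mul_one] at h
  calc G t = G t * Real.exp (-(k * t)) * Real.exp (k * t) := by
        rw [mul_assoc, ← Real.exp_add]
        simp
    _ ≤ G 0 * Real.exp (k * t) := mul_le_mul_of_nonneg_right h (Real.exp_pos _).le
    _ ≤ G 0 * Real.exp (k * T) := mul_le_mul_of_nonneg_left
        (Real.exp_le_exp.2 (mul_le_mul_of_nonneg_left ht.2.le hk)) h0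

/-- The effective velocity `u + μ ρₓ / ρ²`. -/
noncomputable def effectiveVelocity (μ : ℝ) (ρ u : ℝ → ℝ → ℝ) (t x : ℝ) : ℝ :=
  u t x + μ * deriv (ρ t) x / ρ t x ^ 2

/-- The sum of the artificial energy density and the artificial entropy density. -/
noncomputable def entropyDensity (μ γ : ℝ) (W : ℝ → ℝ) (ρ u : ℝ → ℝ → ℝ) (t x : ℝ) : ℝ :=
  1 / 2 * (ρ t x * u t x ^ 2) + 1 / 2 * (ρ t x * effectiveVelocity μ ρ u t x ^ 2)
    + 2 * (W (ρ t x) + γ / 2 * ρ t x ^ 2)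

/-- The flux belonging to `entropyDensity`. -/
noncomputable def entropyFlux (μ γ : ℝ) (W : ℝ → ℝ) (ρ u : ℝ → ℝ → ℝ) (t x : ℝ) : ℝ :=
  1 / 2 * (ρ t x * u t x ^ 3) + 1 / 2 * (ρ t x * u t x * effectiveVelocity μ ρ u t x ^ 2)
    + 2 * ((deriv W (ρ t x) + γ * ρ t x) * (ρ t x * u t x)) - μ * (u t x * deriv (u t) x)

lemma IsPressurePotential.hasDerivAt {P W : ℝ → ℝ} (hW : IsPressurePotential P W) {r : ℝ}
    (hr : 0 < r) : HasDerivAt W (deriv W r) r :=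
  ((hW.smooth.differentiableOn two_ne_zero).differentiableAt (Ioi_mem_nhds hr)).hasDerivAt

lemma IsPressurePotential.contDiffOn_deriv {P W : ℝ → ℝ} (hW : IsPressurePotential P W) :
    ContDiffOn ℝ 1 (deriv W) (Ioi 0) :=
  hW.smooth.deriv_of_isOpen isOpen_Ioi (by norm_num)

lemma IsPressurePotential.hasDerivAt_deriv {P W : ℝ → ℝ} (hW : IsPressurePotential P W) {r : ℝ}
    (hr : 0 < r) : HasDerivAt (deriv W) (deriv (deriv W) r) r :=
  ((hW.contDiffOn_deriv.differentiableOn one_ne_zero).differentiableAt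
    (Ioi_mem_nhds hr)).hasDerivAt

lemma IsAdmissiblePair.hasDerivAt {P : ℝ → ℝ} {γ β a : ℝ} (hP : IsAdmissiblePair P γ β a) {r : ℝ}
    (hr : 0 < r) : HasDerivAt P (deriv P r) r :=
  ((hP.smooth.differentiableOn one_ne_zero).differentiableAt (Ici_mem_nhds hr)).hasDerivAt

lemma IsAdmissiblePair.deriv_artificialPressure_nonneg {P : ℝ → ℝ} {γ β a : ℝ}
    (hP : IsAdmissiblePair P γ β a) {r : ℝ} (hr : 0 < r) : 0 ≤ deriv P r + γ * r := by
  have h : HasDerivAt (artificialPressure P γ) (deriv P r + γ * r) r := by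
    have h2 := (hP.hasDerivAt hr).add ((hasDerivAt_pow 2 r).const_mul (γ / 2))
    refine h2.congr_deriv ?_
    norm_num
    ring
  have hmem : Ici (0 : ℝ) ∈ 𝓝 r := Ici_mem_nhds hr
  have h3 := hP.mono.derivWithin_nonneg (x := r)
  rwa [derivWithin_of_mem_nhds hmem, h.deriv] at h3

section Regularity

variable {μ κ γ T : ℝ} {P W : ℝ → ℝ} {ρ u c : ℝ → ℝ → ℝ} {ρ₀ u₀ : ℝ → ℝ}

lemma contDiffOn_effectiveVelocity (h : IsNSKSolution μ κ γ P (Ico 0 T) ρ u c ρ₀ u₀) :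
    ContDiffOn ℝ ∞ (fun p : ℝ × ℝ => effectiveVelocity μ ρ u p.1 p.2) (Ico 0 T ×ˢ univ) :=
  h.smooth_u.add ((contDiffOn_const.mul
    (contDiffOn_deriv_right (uniqueDiffOn_Ico 0 T) le_rfl h.smooth_rho)).div
    (h.smooth_rho.pow 2) fun p _ => (pow_pos (h.rho_pos p.1 p.2) 2).ne')

lemma contDiffOn_entropyDensity (h : IsNSKSolution μ κ γ P (Ico 0 T) ρ u c ρ₀ u₀)
    (hW : IsPressurePotential P W) :
    ContDiffOn ℝ 1 (fun p : ℝ × ℝ => entropyDensity μ γ W ρ u p.1 p.2) (Ico 0 T ×ˢ univ) := by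
  have h1 : (1 : ℕ∞ω) ≤ ∞ := by norm_num
  have hρ := h.smooth_rho.of_le h1
  have hu := h.smooth_u.of_le h1
  have hV := (contDiffOn_effectiveVelocity h).of_le h1
  have hWρ : ContDiffOn ℝ 1 (fun p : ℝ × ℝ => W (ρ p.1 p.2)) (Ico 0 T ×ˢ univ) :=
    (hW.smooth.of_le (by norm_num)).comp hρ fun p _ => h.rho_pos p.1 p.2
  exact ((contDiffOn_const.mul (hρ.mul (hu.pow 2))).add
    (contDiffOn_const.mul (hρ.mul (hV.pow 2)))).add
    (contDiffOn_const.mul (hWρ.add (contDiffOn_const.mul (hρ.pow 2))))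

lemma contDiffOn_entropyFlux (h : IsNSKSolution μ κ γ P (Ico 0 T) ρ u c ρ₀ u₀)
    (hW : IsPressurePotential P W) :
    ContDiffOn ℝ 1 (fun p : ℝ × ℝ => entropyFlux μ γ W ρ u p.1 p.2) (Ico 0 T ×ˢ univ) := by
  have h1 : (1 : ℕ∞ω) ≤ ∞ := by norm_num
  have hρ := h.smooth_rho.of_le h1
  have hu := h.smooth_u.of_le h1
  have hux := (contDiffOn_deriv_right (uniqueDiffOn_Ico 0 T) le_rfl h.smooth_u).of_le h1
  have hV := (contDiffOn_effectiveVelocity h).of_le h1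
  have hWρ : ContDiffOn ℝ 1 (fun p : ℝ × ℝ => deriv W (ρ p.1 p.2)) (Ico 0 T ×ˢ univ) :=
    hW.contDiffOn_deriv.comp hρ fun p _ => h.rho_pos p.1 p.2
  exact (((contDiffOn_const.mul (hρ.mul (hu.pow 3))).add
    (contDiffOn_const.mul ((hρ.mul hu).mul (hV.pow 2)))).add
    (contDiffOn_const.mul ((hWρ.add (contDiffOn_const.mul hρ)).mul (hρ.mul hu)))).sub
    (contDiffOn_const.mul (hu.mul hux))

lemma entropyFlux_periodic (h : IsNSKSolution μ κ γ P (Ico 0 T) ρ u c ρ₀ u₀) (t x : ℝ) :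
    entropyFlux μ γ W ρ u t (x + 1) = entropyFlux μ γ W ρ u t x := by
  simp only [entropyFlux, effectiveVelocity, h.periodic_rho, h.periodic_u,
    deriv_periodic (h.periodic_rho t), deriv_periodic (h.periodic_u t)]

end Regularity

/-- The entropy balance: production minus dissipation, with the dissipation dropped. -/
lemma entropy_balance_le {μ κ γ β a T : ℝ} {P W : ℝ → ℝ} {ρ u c : ℝ → ℝ → ℝ} {ρ₀ u₀ : ℝ → ℝ}
    (hμ : 0 < μ) (hP : IsAdmissiblePair P γ β a) (hW : IsPressurePotential P W)
    (h : IsNSKSolution μ κ γ P (Ico 0 T) ρ u c ρ₀ u₀) {t : ℝ} (ht : t ∈ Ioo 0 T) (x : ℝ) :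
    deriv (fun s => entropyDensity μ γ W ρ u s x) t + deriv (entropyFlux μ γ W ρ u t) x
      ≤ γ * (ρ t x * ((u t x + effectiveVelocity μ ρ u t x) * deriv (c t) x)) := by
  have htI : t ∈ Ico 0 T := Ioo_subset_Ico_self ht
  have hO : IsOpen (Ioo 0 T) := isOpen_Ioo
  have hsub : Ioo 0 T ×ˢ (univ : Set ℝ) ⊆ Ico 0 T ×ˢ univ :=
    prod_mono Ioo_subset_Ico_self subset_rfl
  have hn : (∞ : ℕ∞ω) ≠ 0 := by norm_num
  have sρ := h.smooth_rho.mono hsub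
  have su := h.smooth_u.mono hsub
  have sρx := contDiffOn_deriv_right hO.uniqueDiffOn (m := ∞) le_rfl sρ
  have sux := contDiffOn_deriv_right hO.uniqueDiffOn (m := ∞) le_rfl su
  have hr : 0 < ρ t x := h.rho_pos t x
  have dρt := (hasDerivAt_slice_left hO hn sρ ht x).differentiableAt.hasDerivAt
  have dut := (hasDerivAt_slice_left hO hn su ht x).differentiableAt.hasDerivAt
  have dρx : ∀ y, HasDerivAt (ρ t) (deriv (ρ t) y) y := fun y =>
    (differentiable_slice_right hn sρ ht y).hasDerivAt
  have dux : ∀ y, HasDerivAt (u t) (deriv (u t) y) y := fun y =>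
    (differentiable_slice_right hn su ht y).hasDerivAt
  have dcx : HasDerivAt (c t) (deriv (c t) x) x :=
    (differentiable_slice_right hn h.smooth_c htI x).hasDerivAt
  have dρxx : HasDerivAt (deriv (ρ t)) (deriv (deriv (ρ t)) x) x :=
    (differentiable_slice_right (f := fun s y => deriv (ρ s) y) hn sρx ht x).hasDerivAt
  have duxx : HasDerivAt (deriv (u t)) (deriv (deriv (u t)) x) x :=
    (differentiable_slice_right (f := fun s y => deriv (u s) y) hn sux ht x).hasDerivAt
  have dρxt : HasDerivAt (fun s => deriv (ρ s) x) (deriv (fun s => deriv (ρ s) x) t) t :=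
    (hasDerivAt_slice_left (f := fun s y => deriv (ρ s) y) hO hn sρx ht x
      ).differentiableAt.hasDerivAt
  have mass : ∀ y, deriv (fun s => ρ s y) t = -(deriv (ρ t) y * u t y + ρ t y * deriv (u t) y) :=
    fun y => by
      have := h.mass t htI y
      have e : deriv (fun y => ρ t y * u t y) y = _ := ((dρx y).mul (dux y)).deriv
      linarith
  have massx : deriv (fun s => deriv (ρ s) x) t = -((deriv (deriv (ρ t)) x * u t x
      + deriv (ρ t) x * deriv (u t) x) + (deriv (ρ t) x * deriv (u t) x
      + ρ t x * deriv (deriv (u t)) x)) := by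
    rw [deriv_deriv_comm hO (sρ.of_le ENat.LEInfty.out) ht x, funext mass]
    exact ((dρxx.mul (dux x)).add ((dρx x).mul duxx)).neg.deriv
  have mom := h.momentum t htI x
  have e1 : deriv (fun s => ρ s x * u s x) t = _ := (dρt.mul dut).deriv
  have e2 : deriv (fun y => ρ t y * u t y ^ 2) x = _ := ((dρx x).mul ((dux x).pow 2)).deriv
  have e3 : deriv (fun y => P (ρ t y)) x = _ := ((hP.hasDerivAt hr).comp x (dρx x)).deriv
  have e4 : deriv (fun y => c t y - ρ t y) x = _ := (dcx.sub (dρx x)).deriv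
  rw [e1, e2, e3, e4] at mom
  have hWr := hW.relation _ hr
  have hPnn := hP.deriv_artificialPressure_nonneg hr
  have dVt : HasDerivAt (fun s => effectiveVelocity μ ρ u s x) _ t :=
    dut.add ((dρxt.const_mul μ).div (dρt.pow 2) (pow_pos hr 2).ne')
  have dVx : HasDerivAt (effectiveVelocity μ ρ u t) _ x :=
    (dux x).add ((dρxx.const_mul μ).div ((dρx x).pow 2) (pow_pos hr 2).ne')
  have dgt : HasDerivAt (fun s => entropyDensity μ γ W ρ u s x) _ t :=
    (((dρt.mul (dut.pow 2)).const_mul (1 / 2)).add ((dρt.mul (dVt.pow 2)).const_mul (1 / 2))).add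
      ((((hW.hasDerivAt hr).comp t dρt).add ((dρt.pow 2).const_mul (γ / 2))).const_mul 2)
  have dhx : HasDerivAt (entropyFlux μ γ W ρ u t) _ x :=
    (((((dρx x).mul ((dux x).pow 3)).const_mul (1 / 2)).add
      ((((dρx x).mul (dux x)).mul (dVx.pow 2)).const_mul (1 / 2))).add
      (((((hW.hasDerivAt_deriv hr).comp x (dρx x)).add ((dρx x).const_mul γ)).mul
        ((dρx x).mul (dux x))).const_mul 2)).sub (((dux x).mul duxx).const_mul μ)
  rw [dgt.deriv, dhx.deriv]
  have hdiss : 0 ≤ μ * deriv (u t) x ^ 2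
      + μ * ((deriv P (ρ t x) + γ * ρ t x) * (deriv (ρ t) x ^ 2 / ρ t x ^ 2)) := by
    positivity
  rw [← sub_nonneg]
  refine hdiss.trans_eq ?_
  simp only [Pi.mul_apply, Pi.pow_apply, Pi.add_apply, Function.comp_apply, Nat.cast_ofNat,
    Nat.add_one_sub_one, pow_one] at mom ⊢
  rw [massx]
  rw [mass x] at mom ⊢
  rw [← hWr] at mom ⊢
  unfold effectiveVelocity
  have hut : deriv (fun s => u s x) t = (μ * deriv (deriv (u t)) x
      + γ * ρ t x * (deriv (c t) x - deriv (ρ t) x)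
      - deriv (deriv W) (ρ t x) * ρ t x * deriv (ρ t) x
      - ρ t x * u t x * deriv (u t) x) / ρ t x := by
    rw [eq_div_iff hr.ne']
    linear_combination mom
  rw [hut]
  field_simp
  ring

/-- Bound for the entropy (plus mass) on `[0, T)`. -/
noncomputable def entropyBound (A B M μ κ γ : ℝ) (W : ℝ → ℝ) (T : ℝ) : ℝ :=
  (2 * M * B ^ 2 + μ ^ 2 * M ^ 3 * A ^ 2 + 2 * sSup (W '' Icc M⁻¹ M) + γ * M ^ 2 + M)
    * Real.exp (γ * (2 * γ / κ * M) * T)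

lemma H1norm_sq (f : ℝ → ℝ) : H1norm f ^ 2 = ∫ x in (0 : ℝ)..1, f x ^ 2 + deriv f x ^ 2 :=
  Real.sq_sqrt (intervalIntegral.integral_nonneg zero_le_one fun x _ => by positivity)

section Bounds

variable {μ κ γ β a T : ℝ} {P W : ℝ → ℝ} {ρ u c : ℝ → ℝ → ℝ} {ρ₀ u₀ : ℝ → ℝ}

lemma continuous_deriv_slice {f : ℝ → ℝ → ℝ}
    (hf : ContDiffOn ℝ ∞ (fun p : ℝ × ℝ => f p.1 p.2) (Ico 0 T ×ˢ univ)) {t : ℝ}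
    (ht : t ∈ Ico 0 T) : Continuous (deriv (f t)) :=
  continuous_slice_right (f := fun s x => deriv (f s) x)
    (contDiffOn_deriv_right (m := ∞) (uniqueDiffOn_Ico 0 T) le_rfl hf).continuousOn ht

/-- The total mass does not increase. -/
lemma mass_le (h : IsNSKSolution μ κ γ P (Ico 0 T) ρ u c ρ₀ u₀) {t : ℝ} (ht : t ∈ Ico 0 T) :
    ∫ x in (0 : ℝ)..1, ρ t x ≤ ∫ x in (0 : ℝ)..1, ρ 0 x := by
  have hsub : Ioo 0 T ×ˢ (univ : Set ℝ) ⊆ Ico 0 T ×ˢ univ :=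
    prod_mono Ioo_subset_Ico_self subset_rfl
  have h1 : (1 : ℕ∞ω) ≤ ∞ := by norm_num
  have hρ := (h.smooth_rho.mono hsub).of_le h1
  have hu := (h.smooth_u.mono hsub).of_le h1
  have := le_mul_exp_of_deriv_le (G := fun s => ∫ x in (0 : ℝ)..1, ρ s x) (G' := fun _ => 0)
    le_rfl (continuousOn_integral_slice h.smooth_rho.continuousOn) (fun s hs => ?_)
    (fun s _ => by simp) ht
    (intervalIntegral.integral_nonneg zero_le_one fun x _ => (h.rho_pos 0 x).le)
  · simpa using this
  · refine (hasDerivAt_integral_balance (h := fun s x => ρ s x * u s x) isOpen_Ioo hρ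
      (hρ.mul hu) (fun r x => by rw [h.periodic_rho, h.periodic_u]) hs).2.congr_deriv ?_
    simp [h.mass s (Ioo_subset_Ico_self hs)]

lemma kinetic_le_entropyDensity (hγ : 0 < γ) (hW : IsPressurePotential P W)
    (h : IsNSKSolution μ κ γ P (Ico 0 T) ρ u c ρ₀ u₀) (t x : ℝ) :
    1 / 2 * (ρ t x * u t x ^ 2) + 1 / 2 * (ρ t x * effectiveVelocity μ ρ u t x ^ 2)
      ≤ entropyDensity μ γ W ρ u t x := by
  have := hW.nonneg _ (h.rho_pos t x).le
  have : 0 ≤ γ / 2 * ρ t x ^ 2 := by positivity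
  unfold entropyDensity
  linarith

/-- Growth estimate for the integrated entropy plus mass. -/
lemma entropy_le (hμ : 0 < μ) (hκ : 0 < κ) (hγ : 0 < γ) {M : ℝ} (hM : 0 < M)
    (hP : IsAdmissiblePair P γ β a) (hW : IsPressurePotential P W)
    (h : IsNSKSolution μ κ γ P (Ico 0 T) ρ u c ρ₀ u₀)
    (hmass : ∫ x in (0 : ℝ)..1, ρ 0 x ≤ M) {t : ℝ} (ht : t ∈ Ico 0 T) :
    ∫ x in (0 : ℝ)..1, (entropyDensity μ γ W ρ u t x + ρ t x) ≤
      (∫ x in (0 : ℝ)..1, (entropyDensity μ γ W ρ u 0 x + ρ 0 x))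
        * Real.exp (γ * (2 * γ / κ * M) * T) := by
  have hsub : Ioo 0 T ×ˢ (univ : Set ℝ) ⊆ Ico 0 T ×ˢ univ :=
    prod_mono Ioo_subset_Ico_self subset_rfl
  have h1 : (1 : ℕ∞ω) ≤ ∞ := by norm_num
  have hn : (∞ : ℕ∞ω) ≠ 0 := by norm_num
  have hρ := h.smooth_rho.of_le h1
  have hu := h.smooth_u.of_le h1
  have hg := (contDiffOn_entropyDensity h hW).add hρ
  have hf := (contDiffOn_entropyFlux h hW).add (hρ.mul hu)
  have hbal : ∀ s ∈ Ioo 0 T, _ := fun s hs => hasDerivAt_integral_balance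
    (g := fun s x => entropyDensity μ γ W ρ u s x + ρ s x)
    (h := fun s x => entropyFlux μ γ W ρ u s x + ρ s x * u s x) isOpen_Ioo (hg.mono hsub)
    (hf.mono hsub)
    (fun r x => by rw [h.periodic_rho, h.periodic_u, entropyFlux_periodic h]) hs
  refine le_mul_exp_of_deriv_le (G := fun s => ∫ x in (0 : ℝ)..1,
    (entropyDensity μ γ W ρ u s x + ρ s x)) (by positivity)
    (continuousOn_integral_slice (g := fun s x => entropyDensity μ γ W ρ u s x + ρ s x)
      hg.continuousOn) (fun s hs => (hbal s hs).2)
    (fun s hs => ?_) ht (intervalIntegral.integral_nonneg zero_le_one fun x _ => ?_)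
  · have hs' := Ioo_subset_Ico_self hs
    rw [← intervalIntegral.integral_const_mul]
    refine intervalIntegral.integral_mono_on zero_le_one ((hbal s hs).1.intervalIntegrable _ _)
      (Continuous.intervalIntegrable (continuous_const.mul (continuous_slice_right
        (f := fun s x => entropyDensity μ γ W ρ u s x + ρ s x) hg.continuousOn hs')) _ _)
      fun x hx => ?_
    have hc' := contDiffOn_deriv_right (m := ∞) (uniqueDiffOn_Ico 0 T) le_rfl h.smooth_c
    have hcx := abs_deriv_le_of_elliptic hκ hγ (differentiable_slice_right hn h.smooth_c hs')
      (differentiable_slice_right (f := fun s x => deriv (c s) x) hn hc' hs')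
      (continuous_deriv_slice (f := fun s x => deriv (c s) x) hc' hs') (h.periodic_c s)
      (continuous_slice_right h.smooth_rho.continuousOn hs') (h.rho_pos s) (h.elliptic s hs') hx
    have hK : |deriv (c s) x| ≤ 2 * γ / κ * M := hcx.trans
      (mul_le_mul_of_nonneg_left ((mass_le h hs').trans hmass) (by positivity))
    have hgs := hasDerivAt_slice_left isOpen_Ioo one_ne_zero
      ((contDiffOn_entropyDensity h hW).mono hsub) hs x
    have hρs := hasDerivAt_slice_left isOpen_Ioo one_ne_zero (hρ.mono hsub) hs x
    have hfx := differentiable_slice_right one_ne_zero (contDiffOn_entropyFlux h hW) hs' x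
    have hρu := differentiable_slice_right (f := fun s x => ρ s x * u s x) one_ne_zero
      (hρ.mul hu) hs' x
    have e1 : deriv (fun r => entropyDensity μ γ W ρ u r x + ρ r x) s = _ :=
      deriv_add hgs.differentiableAt hρs.differentiableAt
    have e2 : deriv (fun y => entropyFlux μ γ W ρ u s y + ρ s y * u s y) x = _ :=
      deriv_add hfx hρu
    have hm := h.mass s hs' x
    have hE := entropy_balance_le hμ hP hW h hs x
    have hN := kinetic_le_entropyDensity hγ hW h s x
    have hr := h.rho_pos s x
    rw [e1, e2]
    set V := effectiveVelocity μ ρ u s x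
    set K := 2 * γ / κ * M
    have hK0 : 0 ≤ K := (abs_nonneg _).trans hK
    have hprod : (u s x + V) * deriv (c s) x ≤ (1 + 1 / 2 * u s x ^ 2 + 1 / 2 * V ^ 2) * K := by
      calc (u s x + V) * deriv (c s) x ≤ |u s x + V| * |deriv (c s) x| := by
            rw [← abs_mul]
            exact le_abs_self _
        _ ≤ (1 + 1 / 2 * u s x ^ 2 + 1 / 2 * V ^ 2) * K := by
            refine mul_le_mul ?_ hK (abs_nonneg _) (by positivity)
            rw [abs_le]
            constructor <;> nlinarith [sq_nonneg (u s x - 1), sq_nonneg (V - 1),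
              sq_nonneg (u s x + 1), sq_nonneg (V + 1)]
    have h3 : γ * (ρ s x * ((u s x + V) * deriv (c s) x)) ≤
        γ * (ρ s x * ((1 + 1 / 2 * u s x ^ 2 + 1 / 2 * V ^ 2) * K)) := by gcongr
    have h4 : γ * K * (1 / 2 * (ρ s x * u s x ^ 2) + 1 / 2 * (ρ s x * V ^ 2))
        ≤ γ * K * entropyDensity μ γ W ρ u s x :=
      mul_le_mul_of_nonneg_left hN (by positivity)
    linarith
  · have hN := kinetic_le_entropyDensity hγ hW h 0 x
    have hr := h.rho_pos 0 x
    have : 0 ≤ 1 / 2 * (ρ 0 x * u 0 x ^ 2)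
      + 1 / 2 * (ρ 0 x * effectiveVelocity μ ρ u 0 x ^ 2) := by positivity
    linarith

/-- The initial entropy is controlled by the data. -/
lemma initial_entropy_le (hμ : 0 < μ) (hγ : 0 < γ) (hT : 0 < T) {M : ℝ} (hM : 0 < M)
    (hW : IsPressurePotential P W) (h : IsNSKSolution μ κ γ P (Ico 0 T) ρ u c ρ₀ u₀)
    (hb : ∀ x, M⁻¹ ≤ ρ 0 x ∧ ρ 0 x ≤ M) :
    ∫ x in (0 : ℝ)..1, (entropyDensity μ γ W ρ u 0 x + ρ 0 x) ≤
      2 * M * H1norm (u 0) ^ 2 + μ ^ 2 * M ^ 3 * H1norm (ρ 0) ^ 2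
        + 2 * sSup (W '' Icc M⁻¹ M) + γ * M ^ 2 + M := by
  have h0 : (0 : ℝ) ∈ Ico 0 T := ⟨le_rfl, hT⟩
  have cρ := continuous_slice_right h.smooth_rho.continuousOn h0
  have cu := continuous_slice_right h.smooth_u.continuousOn h0
  have cρ' := continuous_deriv_slice h.smooth_rho h0
  have cu' := continuous_deriv_slice h.smooth_u h0
  have cg := continuous_slice_right (contDiffOn_entropyDensity h hW).continuousOn h0
  have hMi : 0 < M⁻¹ := inv_pos.2 hM
  have hbdd : BddAbove (W '' Icc M⁻¹ M) := (isCompact_Icc.image_of_continuousOn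
    (hW.smooth.continuousOn.mono fun r hr => hMi.trans_le hr.1)).bddAbove
  set S := sSup (W '' Icc M⁻¹ M)
  calc ∫ x in (0 : ℝ)..1, (entropyDensity μ γ W ρ u 0 x + ρ 0 x)
      ≤ ∫ x in (0 : ℝ)..1, (2 * M * (u 0 x ^ 2 + deriv (u 0) x ^ 2)
          + μ ^ 2 * M ^ 3 * (ρ 0 x ^ 2 + deriv (ρ 0) x ^ 2) + (2 * S + γ * M ^ 2 + M)) := by
        refine intervalIntegral.integral_mono_on zero_le_one
          ((cg.add cρ).intervalIntegrable _ _)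
          (Continuous.intervalIntegrable (by fun_prop) _ _) fun x _ => ?_
        have hr := h.rho_pos 0 x
        obtain ⟨hl, hu⟩ := hb x
        have hWx : W (ρ 0 x) ≤ S := le_csSup hbdd ⟨_, ⟨hl, hu⟩, rfl⟩
        have hinv : (ρ 0 x)⁻¹ ≤ M := by
          rw [inv_le_comm₀ hr hM]
          exact hl
        have h1 : ρ 0 x * u 0 x ^ 2 ≤ M * u 0 x ^ 2 := by gcongr
        have h2 : 1 / 2 * (ρ 0 x * effectiveVelocity μ ρ u 0 x ^ 2) ≤
            ρ 0 x * u 0 x ^ 2 + μ ^ 2 * (ρ 0 x)⁻¹ ^ 3 * deriv (ρ 0) x ^ 2 := by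
          have e : ρ 0 x * u 0 x ^ 2 + μ ^ 2 * (ρ 0 x)⁻¹ ^ 3 * deriv (ρ 0) x ^ 2
              - 1 / 2 * (ρ 0 x * effectiveVelocity μ ρ u 0 x ^ 2)
              = 1 / 2 * (ρ 0 x * (u 0 x - μ * deriv (ρ 0) x / ρ 0 x ^ 2) ^ 2) := by
            unfold effectiveVelocity
            field_simp
            ring
          have : 0 ≤ 1 / 2 * (ρ 0 x * (u 0 x - μ * deriv (ρ 0) x / ρ 0 x ^ 2) ^ 2) := by
            positivity
          linarith
        have h3 : μ ^ 2 * (ρ 0 x)⁻¹ ^ 3 * deriv (ρ 0) x ^ 2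
            ≤ μ ^ 2 * M ^ 3 * deriv (ρ 0) x ^ 2 := by gcongr
        have h4 : γ * ρ 0 x ^ 2 ≤ γ * M ^ 2 := by gcongr
        have h5 : 0 ≤ M * u 0 x ^ 2 := by positivity
        have h6 : 0 ≤ 2 * M * deriv (u 0) x ^ 2 := by positivity
        have h7 : 0 ≤ μ ^ 2 * M ^ 3 * ρ 0 x ^ 2 := by positivity
        unfold entropyDensity
        linarith
    _ = _ := by
        rw [intervalIntegral.integral_add (Continuous.intervalIntegrable (by fun_prop) _ _)
          (Continuous.intervalIntegrable (by fun_prop) _ _), intervalIntegral.integral_add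
          (Continuous.intervalIntegrable (by fun_prop) _ _)
          (Continuous.intervalIntegrable (by fun_prop) _ _), intervalIntegral.integral_const_mul,
          intervalIntegral.integral_const_mul, H1norm_sq, H1norm_sq]
        simp
        ring

/-- The Fisher-type information of the density is controlled by the entropy. -/
lemma integral_deriv_sq_div_le (hμ : 0 < μ) (hγ : 0 < γ) (hW : IsPressurePotential P W)
    (h : IsNSKSolution μ κ γ P (Ico 0 T) ρ u c ρ₀ u₀) {t : ℝ} (ht : t ∈ Ico 0 T) :
    ∫ x in (0 : ℝ)..1, deriv (ρ t) x ^ 2 / ρ t x ^ 3 ≤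
      4 / μ ^ 2 * ∫ x in (0 : ℝ)..1, (entropyDensity μ γ W ρ u t x + ρ t x) := by
  have cρ := continuous_slice_right h.smooth_rho.continuousOn ht
  have cρ' := continuous_deriv_slice h.smooth_rho ht
  have cg := continuous_slice_right (contDiffOn_entropyDensity h hW).continuousOn ht
  rw [← intervalIntegral.integral_const_mul]
  refine intervalIntegral.integral_mono_on zero_le_one
    (Continuous.intervalIntegrable ((cρ'.pow 2).div (cρ.pow 3)
      fun x => (pow_pos (h.rho_pos t x) 3).ne') _ _)
    (Continuous.intervalIntegrable (by fun_prop) _ _) fun x _ => ?_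
  have hr := h.rho_pos t x
  have hN := kinetic_le_entropyDensity hγ hW h t x
  have e : 4 / μ ^ 2 * (1 / 2 * (ρ t x * u t x ^ 2)
      + 1 / 2 * (ρ t x * effectiveVelocity μ ρ u t x ^ 2)) - deriv (ρ t) x ^ 2 / ρ t x ^ 3
      = ρ t x * (u t x + effectiveVelocity μ ρ u t x) ^ 2 / μ ^ 2 := by
    unfold effectiveVelocity
    field_simp
    ring
  have : 0 ≤ ρ t x * (u t x + effectiveVelocity μ ρ u t x) ^ 2 / μ ^ 2 := by positivity
  calc deriv (ρ t) x ^ 2 / ρ t x ^ 3 ≤ 4 / μ ^ 2 * (1 / 2 * (ρ t x * u t x ^ 2)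
      + 1 / 2 * (ρ t x * effectiveVelocity μ ρ u t x ^ 2)) := by linarith
    _ ≤ _ := mul_le_mul_of_nonneg_left (by linarith) (by positivity)

end Bounds

/-- Upper bound for a density of mass at most `M` and Fisher-type information at most `L`. -/
noncomputable def densityBound (M L : ℝ) : ℝ := M * Real.exp ((M + L) / 2)

lemma H1norm_le_of_integral_le {r : ℝ → ℝ} {M L : ℝ} (hM : 0 < M) (hr : ∀ x, 0 < r x)
    (hd : Differentiable ℝ r) (hd' : Continuous (deriv r))
    (hmass : ∫ x in (0 : ℝ)..1, r x ≤ M)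
    (hL : ∫ x in (0 : ℝ)..1, deriv r x ^ 2 / r x ^ 3 ≤ L) :
    H1norm r ≤ Real.sqrt (densityBound M L ^ 2 + densityBound M L ^ 3 * L) := by
  have hc := hd.continuous
  set R := densityBound M L with hR
  have hR0 : 0 < R := mul_pos hM (Real.exp_pos _)
  have hq3 : Continuous fun z => deriv r z ^ 2 / r z ^ 3 :=
    (hd'.pow 2).div (hc.pow 3) fun z => pow_ne_zero _ (hr z).ne'
  refine Real.sqrt_le_sqrt ?_
  calc ∫ x in (0 : ℝ)..1, r x ^ 2 + deriv r x ^ 2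
      ≤ ∫ x in (0 : ℝ)..1, (R ^ 2 + R ^ 3 * (deriv r x ^ 2 / r x ^ 3)) := by
        refine intervalIntegral.integral_mono_on zero_le_one
          (Continuous.intervalIntegrable (by fun_prop) _ _)
          (Continuous.intervalIntegrable (by fun_prop) _ _) fun x hx => ?_
        have hx0 := hr x
        have hxR : r x ≤ R := le_exp_of_integral_le hM hr hd hd' hmass hL hx
        have h1 : deriv r x ^ 2 = r x ^ 3 * (deriv r x ^ 2 / r x ^ 3) := by field_simp
        rw [h1]
        have h2 : r x ^ 3 * (deriv r x ^ 2 / r x ^ 3) ≤ R ^ 3 * (deriv r x ^ 2 / r x ^ 3) := by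
          gcongr
        have h3 : r x ^ 2 ≤ R ^ 2 := by gcongr
        rw [← h1] at h2 ⊢
        exact add_le_add h3 h2
    _ = R ^ 2 + R ^ 3 * ∫ x in (0 : ℝ)..1, deriv r x ^ 2 / r x ^ 3 := by
        rw [intervalIntegral.integral_add (Continuous.intervalIntegrable (by fun_prop) _ _)
          (Continuous.intervalIntegrable (by fun_prop) _ _), intervalIntegral.integral_const_mul]
        simp
    _ ≤ R ^ 2 + R ^ 3 * L := by gcongr

/-- Uniform-in-time `H¹` bound for the density: there is `C(T₀) > 0`, depending only
on `‖ρ₀‖_{H¹}`, `‖u₀‖_{H¹}`, `M₀`, `μ`, `κ`, `γ`, `W` and `T₀`, such that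
`‖ρ(t,·)‖_{H¹(𝕋)} ≤ C(T₀)` for all `t ∈ [0,T₀)`. -/
theorem density_H1_bound :
    ∃ C : ℝ → ℝ → ℝ → ℝ → ℝ → ℝ → (ℝ → ℝ) → ℝ → ℝ,
      ∀ (μ κ γ M₀ T₀ β a : ℝ) (P W : ℝ → ℝ) (ρ u c : ℝ → ℝ → ℝ) (ρ₀ u₀ : ℝ → ℝ),
        0 < μ → 0 < κ → 0 < γ → 0 < M₀ → 0 < T₀ →
        IsAdmissiblePair P γ β a → IsPressurePotential P W →
        IsNSKSolution μ κ γ P (Set.Ico 0 T₀) ρ u c ρ₀ u₀ →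
        (∀ x : ℝ, M₀⁻¹ ≤ ρ₀ x ∧ ρ₀ x ≤ M₀) →
        0 < C (H1norm ρ₀) (H1norm u₀) M₀ μ κ γ W T₀ ∧
        ∀ t ∈ Set.Ico 0 T₀,
          H1norm (ρ t) ≤ C (H1norm ρ₀) (H1norm u₀) M₀ μ κ γ W T₀ := by
  refine ⟨fun A B M μ κ γ W T => Real.sqrt
    (densityBound M (4 / μ ^ 2 * entropyBound A B M μ κ γ W T) ^ 2
      + densityBound M (4 / μ ^ 2 * entropyBound A B M μ κ γ W T) ^ 3
        * (4 / μ ^ 2 * entropyBound A B M μ κ γ W T)) + 1, ?_⟩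
  intro μ κ γ M T β a P W ρ u c ρ₀ u₀ hμ hκ hγ hM hT hP hW h hb
  refine ⟨by positivity, fun t ht => ?_⟩
  obtain rfl : ρ 0 = ρ₀ := funext h.init_rho
  obtain rfl : u 0 = u₀ := funext h.init_u
  have h0 : (0 : ℝ) ∈ Ico 0 T := ⟨le_rfl, hT⟩
  have hmass : ∫ x in (0 : ℝ)..1, ρ 0 x ≤ M := by
    have := intervalIntegral.integral_mono_on (zero_le_one (α := ℝ))
      ((continuous_slice_right h.smooth_rho.continuousOn h0).intervalIntegrable 0 1)
      (intervalIntegrable_const (μ := volume) (c := M)) fun x _ => (hb x).2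
    simpa using this
  have hE : ∫ x in (0 : ℝ)..1, (entropyDensity μ γ W ρ u t x + ρ t x)
      ≤ entropyBound (H1norm (ρ 0)) (H1norm (u 0)) M μ κ γ W T :=
    (entropy_le hμ hκ hγ hM hP hW h hmass ht).trans
      (mul_le_mul_of_nonneg_right (initial_entropy_le hμ hγ hT hM hW h hb) (Real.exp_pos _).le)
  refine (H1norm_le_of_integral_le hM (h.rho_pos t)
    (differentiable_slice_right (by norm_num) h.smooth_rho ht)
    (continuous_deriv_slice h.smooth_rho ht) ((mass_le h ht).trans hmass)
    ((integral_deriv_sq_div_le hμ hγ hW h ht).trans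
      (mul_le_mul_of_nonneg_left hE (by positivity)))).trans ?_
  exact (lt_add_one _).le
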